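/- The set Ω := {(s, z) ∈ S × ℂ : h(s, φ) ≠ z for all φ ∈ [0, 2π]} is open in E × ℂ, and the function Φ : Ω → ℂ defined by Φ(s, z) := (1/(2π)) ∫₀^{2π} f(φ) / (h(s, φ) − z) dφ is analytic (complex analytic as a function of the pair (s, z)) on Ω. -/

import Mathlib

open Set Metric Topology Real intervalIntegral

noncomputable section

open Filter MeasureTheory

/-- Cauchy estimates for a bounded analytic function on a subset of a normed space. -/
theorem AnalyticOnNhd.norm_iteratedFDeriv_le
    {E F : Type*} [NormedAddCommGroup E] [NormedSpace ℂ E] [NormedAddCommGroup F] [NormedSpace ℂ F]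
    [CompleteSpace F] {g : E → F} {U : Set E} {M δ : ℝ} (hg : AnalyticOnNhd ℂ g U)
    (hM : ∀ x ∈ U, ‖g x‖ ≤ M) (hδ : 0 < δ) (n : ℕ) {x : E} (hx : closedBall x (n * δ) ⊆ U) :
    ‖iteratedFDeriv ℂ n g x‖ ≤ M * (2 / δ) ^ n := by
  induction n generalizing x with
  | zero => simpa using hM x (hx (by simp))
  | succ n ih =>
    have hsub : ∀ y ∈ ball x δ, closedBall y (n * δ) ⊆ U := fun y hy =>
      (closedBall_subset_closedBall' (by
        have := (mem_ball.1 hy).le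
        push_cast
        linarith)).trans hx
    have hbound : ∀ y ∈ ball x δ, ‖iteratedFDeriv ℂ n g y‖ ≤ M * (2 / δ) ^ n :=
      fun y hy => ih (hsub y hy)
    have hd : DifferentiableOn ℂ (iteratedFDeriv ℂ n g) (ball x δ) := fun y hy =>
      ((hg.iteratedFDeriv n) y (hsub y hy (mem_closedBall_self (by positivity))))
        |>.differentiableAt.differentiableWithinAt
    have hmaps : MapsTo (iteratedFDeriv ℂ n g) (ball x δ)
        (closedBall (iteratedFDeriv ℂ n g x) (2 * (M * (2 / δ) ^ n))) := fun y hy => by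
      rw [mem_closedBall, dist_eq_norm]
      have := norm_sub_le (iteratedFDeriv ℂ n g y) (iteratedFDeriv ℂ n g x)
      linarith [hbound y hy, hbound x (mem_ball_self hδ)]
    rw [← norm_fderiv_iteratedFDeriv]
    refine (Complex.norm_fderiv_le_div_of_mapsTo_ball hd hmaps hδ).trans_eq ?_
    ring

/-- The iterated derivatives of an analytic function along a complex line. -/
theorem AnalyticOnNhd.iteratedDeriv_comp_add_smul
    {E F : Type*} [NormedAddCommGroup E] [NormedSpace ℂ E] [NormedAddCommGroup F] [NormedSpace ℂ F]
    [CompleteSpace F] {g : E → F} {U : Set E} (hU : IsOpen U) (hg : AnalyticOnNhd ℂ g U)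
    (x y : E) (n : ℕ) {t : ℂ} (ht : x + t • y ∈ U) :
    iteratedDeriv n (fun t : ℂ => g (x + t • y)) t =
      iteratedFDeriv ℂ n g (x + t • y) fun _ => y := by
  induction n generalizing t with
  | zero => simp
  | succ n ih =>
    have hev : iteratedDeriv n (fun t : ℂ => g (x + t • y)) =ᶠ[𝓝 t]
        fun t => iteratedFDeriv ℂ n g (x + t • y) fun _ => y := by
      have hc : ContinuousAt (fun t : ℂ => x + t • y) t := by fun_prop
      filter_upwards [hc (hU.mem_nhds ht)] with s hs using ih hs
    rw [iteratedDeriv_succ, hev.deriv_eq, iteratedFDeriv_succ_apply_left]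
    have hline : HasDerivAt (fun t : ℂ => x + t • y) y t := by
      simpa using ((hasDerivAt_id t).smul_const y).const_add x
    have hd := ((hg.iteratedFDeriv n) _ ht).differentiableAt.hasFDerivAt.comp_hasDerivAt t hline
    exact ((ContinuousMultilinearMap.apply ℂ (fun _ : Fin n => E) F
      fun _ => y).hasFDerivAt.comp_hasDerivAt t hd).deriv

/-- The Taylor series of a function analytic on a ball of a normed space converges to it on the
whole ball. -/
theorem AnalyticOnNhd.hasSum_iteratedFDeriv_ball
    {E F : Type*} [NormedAddCommGroup E] [NormedSpace ℂ E] [NormedAddCommGroup F] [NormedSpace ℂ F]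
    [CompleteSpace F] {g : E → F} {x y : E} {r : ℝ} (hg : AnalyticOnNhd ℂ g (ball x r))
    (hy : ‖y‖ < r) :
    HasSum (fun n : ℕ => (n.factorial : ℂ)⁻¹ • iteratedFDeriv ℂ n g x fun _ => y) (g (x + y)) := by
  obtain ⟨ρ, hρ, hρr⟩ : ∃ ρ : ℝ, 1 < ρ ∧ ρ * ‖y‖ < r := by
    have hc : ContinuousAt (fun ρ : ℝ => ρ * ‖y‖) 1 := by fun_prop
    have hev : ∀ᶠ ρ : ℝ in 𝓝[>] 1, ρ * ‖y‖ < r :=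
      (hc.eventually_lt_const (by simpa using hy)).filter_mono nhdsWithin_le_nhds
    exact (eventually_mem_nhdsWithin.and hev).exists
  have hmem : ∀ t ∈ ball (0 : ℂ) ρ, x + t • y ∈ ball x r := fun t ht => by
    rw [mem_ball_iff_norm, add_sub_cancel_left, norm_smul]
    rw [mem_ball_zero_iff] at ht
    exact (mul_le_mul_of_nonneg_right ht.le (norm_nonneg y)).trans_lt hρr
  have hd : DifferentiableOn ℂ (fun t : ℂ => g (x + t • y)) (ball 0 ρ) := fun t ht =>
    ((hg _ (hmem t ht)).differentiableAt.comp t (f := fun t : ℂ => x + t • y)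
      (by fun_prop)).differentiableWithinAt
  have h0 : (0 : ℂ) ∈ ball (0 : ℂ) ρ := mem_ball_self (zero_lt_one.trans hρ)
  have hsum := Complex.hasSum_taylorSeries_on_ball hd (z := 1) (by simpa using hρ)
  simpa [hg.iteratedDeriv_comp_add_smul isOpen_ball x y _ (hmem 0 h0)] using hsum

/-- The iterated derivatives of a measurable family of analytic functions, evaluated at fixed
vectors, depend measurably on the parameter. -/
theorem aestronglyMeasurable_iteratedFDeriv_apply
    {α E F : Type*} [MeasurableSpace α] {μ : Measure α}
    [NormedAddCommGroup E] [NormedSpace ℂ E] [NormedAddCommGroup F] [NormedSpace ℂ F]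
    [CompleteSpace F] {G : α → E → F} {U : Set E} (hU : IsOpen U)
    (hG : ∀ᵐ a ∂μ, AnalyticOnNhd ℂ (G a) U)
    (hmeas : ∀ x ∈ U, AEStronglyMeasurable (fun a => G a x) μ)
    (n : ℕ) (v : Fin n → E) {x : E} (hx : x ∈ U) :
    AEStronglyMeasurable (fun a => iteratedFDeriv ℂ n (G a) x v) μ := by
  induction n generalizing x with
  | zero => simpa using hmeas x hx
  | succ n ih =>
    have hc : ContinuousAt (fun t : ℝ => x + (t : ℂ) • v 0) 0 := by fun_prop
    obtain ⟨u, -, hu, hu0⟩ := exists_seq_strictAnti_tendsto (0 : ℝ)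
    have hlim : Tendsto u atTop (𝓝[≠] 0) :=
      tendsto_nhdsWithin_iff.2 ⟨hu0, .of_forall fun k => (hu k).ne'⟩
    have hUu : ∀ᶠ k in atTop, x + (u k : ℂ) • v 0 ∈ U :=
      hu0.eventually (hc (hU.mem_nhds (by simpa using hx)))
    obtain ⟨N, hN⟩ := eventually_atTop.1 hUu
    refine aestronglyMeasurable_of_tendsto_ae atTop
      (f := fun k a => (u (k + N) : ℂ)⁻¹ • (iteratedFDeriv ℂ n (G a) (x + (u (k + N) : ℂ) • v 0)
        (Fin.tail v) - iteratedFDeriv ℂ n (G a) x (Fin.tail v)))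
      (fun k => ((ih _ (hN _ (Nat.le_add_left _ _))).sub (ih _ hx)).const_smul _) ?_
    filter_upwards [hG] with a ha
    have hline : HasDerivAt (fun t : ℂ => x + t • v 0) (v 0) 0 := by
      simpa using ((hasDerivAt_id (0 : ℂ)).smul_const (v 0)).const_add x
    have hd : HasFDerivAt (iteratedFDeriv ℂ n (G a))
        (fderiv ℂ (iteratedFDeriv ℂ n (G a)) x) (x + (0 : ℂ) • v 0) := by
      simpa using ((ha.iteratedFDeriv n) _ hx).differentiableAt.hasFDerivAt
    have hderiv := (ContinuousMultilinearMap.apply ℂ (fun _ : Fin n => E) F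
      (Fin.tail v)).hasFDerivAt.comp_hasDerivAt 0 (hd.comp_hasDerivAt 0 hline)
    have hofReal : Tendsto (fun k => (u (k + N) : ℂ)) atTop (𝓝[≠] 0) := by
      refine tendsto_nhdsWithin_iff.2 ⟨?_, .of_forall fun k => by simpa using (hu (k + N)).ne'⟩
      exact_mod_cast (Complex.continuous_ofReal.tendsto 0).comp
        (hu0.comp (tendsto_add_atTop_nat N))
    rw [iteratedFDeriv_succ_apply_left]
    simpa [Function.comp_def] using hderiv.tendsto_slope_zero.comp hofReal

/-- If `G a` is a uniformly bounded measurable family of analytic functions on an open subset of a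
normed space, then its integral over a finite measure is analytic. The derivatives of `G a` need
not be measurable for the operator norm, so the power series is integrated pointwise. -/
theorem analyticOnNhd_integral_of_bounded
    {α E F : Type*} [MeasurableSpace α] {μ : Measure α} [IsFiniteMeasure μ]
    [NormedAddCommGroup E] [NormedSpace ℂ E] [NormedAddCommGroup F] [NormedSpace ℂ F]
    [CompleteSpace F] {G : α → E → F} {U : Set E} {M : ℝ} (hU : IsOpen U)
    (hG : ∀ᵐ a ∂μ, AnalyticOnNhd ℂ (G a) U)
    (hmeas : ∀ x ∈ U, AEStronglyMeasurable (fun a => G a x) μ)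
    (hM : ∀ᵐ a ∂μ, ∀ x ∈ U, ‖G a x‖ ≤ M) :
    AnalyticOnNhd ℂ (fun x => ∫ a, G a x ∂μ) U := by
  intro x hx
  wlog hM0 : 0 ≤ M generalizing M
  · exact this (M := |M|) (hM.mono fun a ha x hx => (ha x hx).trans (le_abs_self M)) (abs_nonneg M)
  obtain ⟨r, hr, hrU⟩ := Metric.isOpen_iff.1 hU x hx
  set C : ℝ := 2 * exp 1 / r with hC
  have hC0 : 0 < C := by positivity
  have hbound : ∀ n : ℕ, ∀ᵐ a ∂μ,
      ‖(n.factorial : ℂ)⁻¹ • iteratedFDeriv ℂ n (G a) x‖ ≤ M * exp 1 * C ^ n := fun n => by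
    filter_upwards [hG, hM] with a ha hMa
    have hsub : closedBall x (n * (r / (n + 1))) ⊆ U := by
      refine (closedBall_subset_ball ?_).trans hrU
      rw [mul_div_assoc', div_lt_iff₀ (by positivity)]
      nlinarith
    have hder := ha.norm_iteratedFDeriv_le hMa (by positivity) n hsub
    have hexp : ((n : ℝ) + 1) ^ n / n.factorial ≤ exp 1 * exp 1 ^ n := by
      refine (Real.pow_div_factorial_le_exp _ (by positivity) n).trans_eq ?_
      rw [← Real.exp_nat_mul, ← Real.exp_add]
      ring_nf
    rw [norm_smul, norm_inv, Complex.norm_natCast]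
    calc (n.factorial : ℝ)⁻¹ * ‖iteratedFDeriv ℂ n (G a) x‖
        ≤ (n.factorial : ℝ)⁻¹ * (M * (2 / (r / (n + 1))) ^ n) := by gcongr
      _ = M * (2 / r) ^ n * (((n : ℝ) + 1) ^ n / n.factorial) := by
        rw [div_div_eq_mul_div, mul_div_right_comm, mul_pow]
        ring
      _ ≤ M * (2 / r) ^ n * (exp 1 * exp 1 ^ n) := by gcongr
      _ = M * exp 1 * C ^ n := by
        rw [hC, mul_div_right_comm, mul_pow]
        ring
  have hterm : ∀ (n : ℕ) (v : Fin n → E), ∀ᵐ a ∂μ,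
      ‖(n.factorial : ℂ)⁻¹ • iteratedFDeriv ℂ n (G a) x v‖ ≤ M * exp 1 * C ^ n * ∏ i, ‖v i‖ :=
    fun n v => by
      filter_upwards [hbound n] with a ha
      exact ((n.factorial : ℂ)⁻¹ • iteratedFDeriv ℂ n (G a) x).le_of_opNorm_le ha v
  have hint : ∀ (n : ℕ) (v : Fin n → E),
      Integrable (fun a => (n.factorial : ℂ)⁻¹ • iteratedFDeriv ℂ n (G a) x v) μ := fun n v =>
    .of_bound ((aestronglyMeasurable_iteratedFDeriv_apply hU hG hmeas n v hx).const_smul _) _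
      (hterm n v)
  have hterm_integral : ∀ (n : ℕ) (v : Fin n → E),
      ‖∫ a, (n.factorial : ℂ)⁻¹ • iteratedFDeriv ℂ n (G a) x v ∂μ‖ ≤
        M * exp 1 * C ^ n * μ.real univ * ∏ i, ‖v i‖ := fun n v =>
    (norm_integral_le_of_norm_le_const (hterm n v)).trans_eq (by ring)
  let p : FormalMultilinearSeries ℂ E F := fun n => MultilinearMap.mkContinuous
    { toFun := fun v => ∫ a, (n.factorial : ℂ)⁻¹ • iteratedFDeriv ℂ n (G a) x v ∂μ
      map_update_add' := fun v i y z => by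
        rw [← integral_add (hint n _) (hint n _)]
        simp only [ContinuousMultilinearMap.map_update_add, smul_add]
      map_update_smul' := fun v i c y => by
        rw [← MeasureTheory.integral_smul]
        simp only [ContinuousMultilinearMap.map_update_smul, smul_comm c] }
    (M * exp 1 * C ^ n * μ.real univ) (hterm_integral n)
  have hρ0 : 0 < (2 * C)⁻¹ := by positivity
  have hρr : (2 * C)⁻¹ ≤ r := by
    have he : 1 ≤ exp 1 := Real.one_le_exp zero_le_one
    rw [hC, inv_le_iff_one_le_mul₀ (by positivity)]
    field_simp
    linarith
  have hCρ : ∀ n : ℕ, C ^ n * (2 * C)⁻¹ ^ n = (1 / 2) ^ n := fun n => by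
    rw [← mul_pow]
    congr 1
    field_simp
  have hps : HasFPowerSeriesOnBall (fun x => ∫ a, G a x ∂μ) p x (ENNReal.ofReal (2 * C)⁻¹) := by
    refine ⟨?_, by simpa using hC0, fun {y} hy => ?_⟩
    · refine p.le_radius_of_bound (M * exp 1 * μ.real univ) fun n => ?_
      rw [Real.coe_toNNReal _ hρ0.le]
      calc ‖p n‖ * (2 * C)⁻¹ ^ n
          ≤ M * exp 1 * C ^ n * μ.real univ * (2 * C)⁻¹ ^ n := by
            gcongr
            exact MultilinearMap.mkContinuous_norm_le _ (by positivity) _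
        _ = M * exp 1 * μ.real univ * (1 / 2) ^ n := by
            rw [← hCρ]
            ring
        _ ≤ M * exp 1 * μ.real univ :=
            mul_le_of_le_one_right (by positivity) (pow_le_one₀ (by norm_num) (by norm_num))
    · have hy' : ‖y‖ < (2 * C)⁻¹ := by
        rwa [Metric.eball_ofReal, mem_ball_zero_iff] at hy
      have hdom : ∀ n : ℕ, ∀ᵐ a ∂μ,
          ‖(n.factorial : ℂ)⁻¹ • iteratedFDeriv ℂ n (G a) x fun _ => y‖ ≤
            M * exp 1 * (1 / 2) ^ n := fun n => by
        filter_upwards [hterm n fun _ => y] with a ha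
        refine ha.trans ?_
        rw [Finset.prod_const, Finset.card_univ, Fintype.card_fin, ← hCρ, ← mul_assoc]
        gcongr
      have hgeom : Summable fun n : ℕ => M * exp 1 * (1 / 2 : ℝ) ^ n :=
        summable_geometric_two.mul_left _
      refine hasSum_integral_of_dominated_convergence (fun n _ => M * exp 1 * (1 / 2) ^ n)
        (fun n => (hint n _).aestronglyMeasurable) hdom (.of_forall fun _ => hgeom)
        (integrable_const _) ?_
      filter_upwards [hG] with a ha
      exact (ha.mono hrU).hasSum_iteratedFDeriv_ball (hy'.trans_le hρr)
  exact hps.analyticAt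

/-- Openness of the set `Ω = {(s, z) ∈ S × ℂ : h(s, φ) ≠ z for all φ ∈ [0, 2π]}`
and complex analyticity in the pair `(s, z)` of the Cauchy-type integral
`Φ(s, z) = (1/2π) ∫₀^{2π} f(φ) / (h(s, φ) − z) dφ`. -/
theorem cauchyTypeIntegral_analytic
    {E : Type*} [NormedAddCommGroup E] [NormedSpace ℂ E] [CompleteSpace E]
    (S : Set E) (hS : IsOpen S)
    (h : E → ℝ → ℂ)
    (hcont : ContinuousOn (fun p : E × ℝ => h p.1 p.2) (S ×ˢ Icc 0 (2 * π)))
    (hanal : ∀ φ ∈ Icc (0 : ℝ) (2 * π), AnalyticOnNhd ℂ (fun s => h s φ) S)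
    (f : ℝ → ℂ) (hf : Continuous f) :
    IsOpen {p : E × ℂ | p.1 ∈ S ∧ ∀ φ ∈ Icc (0 : ℝ) (2 * π), h p.1 φ ≠ p.2} ∧
      AnalyticOnNhd ℂ
        (fun p : E × ℂ =>
          (1 / (2 * π) : ℂ) * ∫ φ in (0 : ℝ)..(2 * π), f φ / (h p.1 φ - p.2))
        {p : E × ℂ | p.1 ∈ S ∧ ∀ φ ∈ Icc (0 : ℝ) (2 * π), h p.1 φ ≠ p.2} := by
  have hnhds : ∀ p ∈ {p : E × ℂ | p.1 ∈ S ∧ ∀ φ ∈ Icc (0 : ℝ) (2 * π), h p.1 φ ≠ p.2},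
      ∃ M : ℝ, ∀ᶠ q : E × ℂ in 𝓝 p, q.1 ∈ S ∧ ∀ φ : Icc (0 : ℝ) (2 * π),
        h q.1 φ ≠ q.2 ∧ ‖f φ / (h q.1 φ - q.2)‖ < M := by
    rintro p ⟨hpS, hp⟩
    have hden : ∀ φ : Icc (0 : ℝ) (2 * π), ContinuousAt
        (fun z : (E × ℂ) × Icc (0 : ℝ) (2 * π) => h z.1.1 z.2 - z.1.2) (p, φ) := fun φ => by
      have hmaps : ∀ᶠ z : (E × ℂ) × Icc (0 : ℝ) (2 * π) in 𝓝 (p, φ),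
          (z.1.1, (z.2 : ℝ)) ∈ S ×ˢ Icc (0 : ℝ) (2 * π) := by
        have hfst : ContinuousAt (fun z : (E × ℂ) × Icc (0 : ℝ) (2 * π) => z.1.1) (p, φ) := by
          fun_prop
        filter_upwards [hfst (hS.mem_nhds hpS)] with z hz using ⟨hz, z.2.2⟩
      have hpair : ContinuousAt
          (fun z : (E × ℂ) × Icc (0 : ℝ) (2 * π) => (z.1.1, (z.2 : ℝ))) (p, φ) := by fun_prop
      have hh : ContinuousAt
          (fun z : (E × ℂ) × Icc (0 : ℝ) (2 * π) => h z.1.1 z.2) (p, φ) :=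
        (hcont (p.1, φ) ⟨hpS, φ.2⟩).tendsto.comp (tendsto_nhdsWithin_iff.2 ⟨hpair, hmaps⟩)
      exact hh.sub (by fun_prop)
    have hquot : ∀ φ : Icc (0 : ℝ) (2 * π), ContinuousAt
        (fun z : (E × ℂ) × Icc (0 : ℝ) (2 * π) => ‖f z.2 / (h z.1.1 z.2 - z.1.2)‖) (p, φ) :=
      fun φ => (ContinuousAt.div (by fun_prop) (hden φ) (sub_ne_zero.2 (hp φ φ.2))).norm
    have hslice : Continuous fun φ : Icc (0 : ℝ) (2 * π) => ‖f φ / (h p.1 φ - p.2)‖ :=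
      continuous_iff_continuousAt.2 fun φ =>
        (hquot φ).comp (f := fun φ : Icc (0 : ℝ) (2 * π) => (p, φ)) (by fun_prop)
    obtain ⟨M, hM⟩ := (isCompact_range hslice).bddAbove
    refine ⟨M + 1, (continuousAt_fst.eventually_mem (hS.mem_nhds hpS)).and ?_⟩
    have := isCompact_univ.eventually_forall_of_forall_eventually (x₀ := p)
      (P := fun (q : E × ℂ) (φ : Icc (0 : ℝ) (2 * π)) =>
        h q.1 φ ≠ q.2 ∧ ‖f φ / (h q.1 φ - q.2)‖ < M + 1) fun φ _ =>
      (((hden φ).eventually_ne (sub_ne_zero.2 (hp φ φ.2))).mono fun _ => sub_ne_zero.1).and <|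
        (hquot φ).eventually_lt_const ((hM (mem_range_self φ)).trans_lt (lt_add_one M))
    simpa using this
  refine ⟨isOpen_iff_mem_nhds.2 fun p hp => ?_, fun p hp => ?_⟩
  · obtain ⟨M, hM⟩ := hnhds p hp
    filter_upwards [hM] with q hq using ⟨hq.1, fun φ hφ => (hq.2 ⟨φ, hφ⟩).1⟩
  · obtain ⟨M, hM⟩ := hnhds p hp
    obtain ⟨U, hU, hUo, hpU⟩ := _root_.eventually_nhds_iff.1 hM
    have hIoc : ∀ᵐ φ ∂volume.restrict (Ioc (0 : ℝ) (2 * π)), φ ∈ Icc (0 : ℝ) (2 * π) :=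
      (ae_restrict_mem measurableSet_Ioc).mono fun φ hφ => Ioc_subset_Icc_self hφ
    simp only [intervalIntegral.integral_of_le Real.two_pi_pos.le]
    refine analyticAt_const.mul (analyticOnNhd_integral_of_bounded
      (G := fun φ (q : E × ℂ) => f φ / (h q.1 φ - q.2)) (M := M) hUo ?_ ?_ ?_ p hpU)
    · filter_upwards [hIoc] with φ hφ q hq
      obtain ⟨hqS, hq⟩ := hU q hq
      exact analyticAt_const.div (((hanal φ hφ q.1 hqS).comp analyticAt_fst).sub analyticAt_snd)
        (sub_ne_zero.2 (hq ⟨φ, hφ⟩).1)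
    · intro q hq
      obtain ⟨hqS, hq⟩ := hU q hq
      have hh : ContinuousOn (fun φ => h q.1 φ) (Icc 0 (2 * π)) :=
        hcont.comp (f := fun φ => (q.1, φ)) (by fun_prop) fun φ hφ => ⟨hqS, hφ⟩
      exact ((hf.continuousOn.div (hh.sub continuousOn_const) fun φ hφ =>
        sub_ne_zero.2 (hq ⟨φ, hφ⟩).1).mono Ioc_subset_Icc_self).aestronglyMeasurable
          measurableSet_Ioc
    · filter_upwards [hIoc] with φ hφ q hq using ((hU q hq).2 ⟨φ, hφ⟩).2.le
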